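/- Let τ, η, ξ₊, ξ₋ ∈ ℂ with Re(τ) < 0 and set q = e^τ. For z ∈ ℂ let (z;q²)_∞ := ∏_{i=0}^∞ (1 − q^{2i} z). Define g(x) := e^{(2(ξ₋+ξ₊−η)/τ + 1)·x} · (q² e^{2(x+ξ₋)−η}; q²)_∞ · (q e^{2(x+ξ₊)−η}; q²)_∞ / [ (e^{2(x−ξ₋)+η}; q²)_∞ · (q e^{2(x−ξ₊)+η}; q²)_∞ ]. Suppose q^{2i} e^{2(x−ξ₋)+η} ≠ 1 and q^{2i+1} e^{2(x−ξ₊)+η} ≠ 1 for all integers i ≥ 0. Then sinh(ξ₋+x+τ−η/2)·sinh(ξ₊+x+τ/2−η/2)·g(x+τ) = sinh(ξ₋−x−η/2)·sinh(ξ₊−x−τ/2−η/2)·g(x). -/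

import Mathlib

open Complex

/-- The q-shifted factorial `(z;q)_∞ := ∏_{i=0}^∞ (1 − qⁱ z)`. -/
noncomputable def qpoch (z q : ℂ) : ℂ := ∏' i : ℕ, (1 - q ^ i * z)

/-- The boundary weight factor (wghtexplicit):
`g(x) = e^{(2(ξ₋+ξ₊−η)/τ + 1)x} · (q² e^{2(x+ξ₋)−η}, q e^{2(x+ξ₊)−η}; q²)_∞
        / (e^{2(x−ξ₋)+η}, q e^{2(x−ξ₊)+η}; q²)_∞`, with `q = e^τ`. -/
noncomputable def gweight (τ η ξp ξm x : ℂ) : ℂ :=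
  Complex.exp ((2 * (ξm + ξp - η) / τ + 1) * x)
    * (qpoch (Complex.exp τ ^ 2 * Complex.exp (2 * (x + ξm) - η)) (Complex.exp τ ^ 2)
        * qpoch (Complex.exp τ * Complex.exp (2 * (x + ξp) - η)) (Complex.exp τ ^ 2))
    / (qpoch (Complex.exp (2 * (x - ξm) + η)) (Complex.exp τ ^ 2)
        * qpoch (Complex.exp τ * Complex.exp (2 * (x - ξp) + η)) (Complex.exp τ ^ 2))

theorem qpoch_step (z q : ℂ) (hq : ‖q‖ < 1) :
    qpoch z q = (1 - z) * qpoch (q * z) q := by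
  unfold qpoch
  have hm : Multipliable (fun i : ℕ => 1 - q ^ (i + 1) * z) := by
    have hs : Summable (fun i : ℕ => ‖-(q ^ (i + 1) * z)‖) := by
      have h := (summable_geometric_of_lt_one (norm_nonneg q) hq).mul_right (‖q‖ * ‖z‖)
      refine h.congr fun i => ?_
      rw [norm_neg, norm_mul, norm_pow]
      ring
    simpa [sub_eq_add_neg] using multipliable_one_add_of_summable hs
  rw [tprod_eq_zero_mul' (f := fun i : ℕ => 1 - q ^ i * z) hm]
  simp only [pow_zero, one_mul]
  congr 1
  refine tprod_congr fun i => ?_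
  ring

theorem one_sub_exp_two (a : ℂ) :
    1 - Complex.exp (2 * a) = -2 * Complex.exp a * sinh a := by
  have h : Complex.exp a * Complex.exp (-a) = 1 := by
    rw [← Complex.exp_add]; simp
  have h2 : Complex.exp (2 * a) = Complex.exp a * Complex.exp a := by
    rw [← Complex.exp_add]; ring_nf
  rw [Complex.sinh, h2]
  linear_combination -h

/-- The functional equation
`g(x+τ) = [sinh(ξ₋−x−η/2)sinh(ξ₊−x−τ/2−η/2)/(sinh(ξ₋+x+τ−η/2)sinh(ξ₊+x+τ/2−η/2))]·g(x)`
for the explicit boundary weight factor, in cleared-denominator form. -/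
theorem gweight_functional_equation (τ η ξp ξm x : ℂ) (hτ : τ.re < 0)
    (hden1 : ∀ i : ℕ, Complex.exp τ ^ (2 * i) * Complex.exp (2 * (x - ξm) + η) ≠ 1)
    (hden2 : ∀ i : ℕ, Complex.exp τ ^ (2 * i + 1) * Complex.exp (2 * (x - ξp) + η) ≠ 1) :
    sinh (ξm + x + τ - η / 2) * sinh (ξp + x + τ / 2 - η / 2)
        * gweight τ η ξp ξm (x + τ)
      = sinh (ξm - x - η / 2) * sinh (ξp - x - τ / 2 - η / 2)
        * gweight τ η ξp ξm x := by
  have hτ0 : τ ≠ 0 := by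
    rintro rfl
    simp at hτ
  have hq : ‖Complex.exp τ ^ 2‖ < 1 := by
    rw [norm_pow, Complex.norm_exp]
    exact pow_lt_one₀ (Real.exp_pos _).le (by simpa using hτ) two_ne_zero
  have hsh : ∀ u v : ℂ, v = 2 * τ + u →
      Complex.exp v = Complex.exp τ ^ 2 * Complex.exp u := by
    intro u v h
    rw [h, Complex.exp_add, ← Complex.exp_nat_mul]
    norm_num
  have hC0 := hden1 0
  have hD0 := hden2 0
  simp only [mul_zero, pow_zero, one_mul, zero_add, pow_one] at hC0 hD0
  have hW : Complex.exp ((2 * (ξm + ξp - η) / τ + 1) * (x + τ))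
      = Complex.exp ((2 * (ξm + ξp - η) / τ + 1) * x)
        * Complex.exp (2 * (ξm + ξp - η) + τ) := by
    rw [← Complex.exp_add]
    congr 1
    field_simp
  unfold gweight
  rw [hW, hsh (2 * (x + ξm) - η) (2 * (x + τ + ξm) - η) (by ring),
    hsh (2 * (x + ξp) - η) (2 * (x + τ + ξp) - η) (by ring),
    hsh (2 * (x - ξm) + η) (2 * (x + τ - ξm) + η) (by ring),
    hsh (2 * (x - ξp) + η) (2 * (x + τ - ξp) + η) (by ring),
    mul_left_comm (Complex.exp τ) (Complex.exp τ ^ 2) (Complex.exp (2 * (x + ξp) - η)),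
    mul_left_comm (Complex.exp τ) (Complex.exp τ ^ 2) (Complex.exp (2 * (x - ξp) + η)),
    qpoch_step (Complex.exp τ ^ 2 * Complex.exp (2 * (x + ξm) - η)) _ hq,
    qpoch_step (Complex.exp τ * Complex.exp (2 * (x + ξp) - η)) _ hq,
    qpoch_step (Complex.exp (2 * (x - ξm) + η)) _ hq,
    qpoch_step (Complex.exp τ * Complex.exp (2 * (x - ξp) + η)) _ hq]
  have hA : 1 - Complex.exp τ ^ 2 * Complex.exp (2 * (x + ξm) - η)
      = -2 * Complex.exp (ξm + x + τ - η / 2) * sinh (ξm + x + τ - η / 2) := by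
    rw [← one_sub_exp_two, ← hsh _ (2 * (ξm + x + τ - η / 2)) (by ring)]
  have hB : 1 - Complex.exp τ * Complex.exp (2 * (x + ξp) - η)
      = -2 * Complex.exp (ξp + x + τ / 2 - η / 2) * sinh (ξp + x + τ / 2 - η / 2) := by
    rw [← one_sub_exp_two, ← Complex.exp_add]
    ring_nf
  have hC : 1 - Complex.exp (2 * (x - ξm) + η)
      = 2 * Complex.exp (-(ξm - x - η / 2)) * sinh (ξm - x - η / 2) := by
    have h := one_sub_exp_two (-(ξm - x - η / 2))
    rw [Complex.sinh_neg] at h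
    rw [show 2 * (x - ξm) + η = 2 * (-(ξm - x - η / 2)) by ring, h]
    ring
  have hD : 1 - Complex.exp τ * Complex.exp (2 * (x - ξp) + η)
      = 2 * Complex.exp (-(ξp - x - τ / 2 - η / 2)) * sinh (ξp - x - τ / 2 - η / 2) := by
    have h := one_sub_exp_two (-(ξp - x - τ / 2 - η / 2))
    rw [Complex.sinh_neg] at h
    rw [← Complex.exp_add,
      show τ + (2 * (x - ξp) + η) = 2 * (-(ξp - x - τ / 2 - η / 2)) by ring, h]
    ring
  have hE : Complex.exp (2 * (ξm + ξp - η) + τ) * (Complex.exp (-(ξm - x - η / 2))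
        * Complex.exp (-(ξp - x - τ / 2 - η / 2)))
      = Complex.exp (ξm + x + τ - η / 2) * Complex.exp (ξp + x + τ / 2 - η / 2) := by
    simp only [← Complex.exp_add]
    ring_nf
  have hC1 := sub_ne_zero.mpr hC0.symm
  have hD1 := sub_ne_zero.mpr hD0.symm
  have key : ∀ s1 s2 s3 s4 E W A B C D a b c d : ℂ, C ≠ 0 → D ≠ 0 →
      s1 * s2 * W * (C * D) = s3 * s4 * (A * B) →
      s1 * s2 * (E * W * (a * b) / (c * d))
        = s3 * s4 * (E * (A * a * (B * b)) / (C * c * (D * d))) := by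
    intro s1 s2 s3 s4 E W A B C D a b c d hC hD h
    have e : s1 * s2 * W = s3 * s4 * (A * B) / (C * D) := by
      rw [eq_div_iff (mul_ne_zero hC hD), h]
    calc s1 * s2 * (E * W * (a * b) / (c * d))
        = (s1 * s2 * W) * (E * (a * b) / (c * d)) := by ring
      _ = _ := by rw [e]; simp only [div_eq_mul_inv, mul_inv]; ring
  refine key _ _ _ _ _ _ _ _ _ _ _ _ _ _ hC1 hD1 ?_
  rw [hA, hB, hC, hD]
  linear_combination (4 * sinh (ξm + x + τ - η / 2) * sinh (ξp + x + τ / 2 - η / 2)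
    * sinh (ξm - x - η / 2) * sinh (ξp - x - τ / 2 - η / 2)) * hE
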